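/- Let G be a Laman+1 graph and let p be a generic configuration in ℝ². Then an edge e of G is a redundant edge of (G,p) (i.e. deleting the row of e from the rigidity matrix R(p) does not decrease its rank) if and only if e lies in the unique Laman-circuit subgraph of G. -/

import Mathlib

open scoped RealInnerProductSpace

namespace CoordRigidity

variable {V : Type*} [Fintype V] [DecidableEq V] {d k : ℕ}

abbrev Cfg (V : Type*) (d : ℕ) := V → EuclideanSpace ℝ (Fin d)

/-- `p` is generic: its `d|V|` coordinates are algebraically independent over `ℚ`. -/
def Generic (p : Cfg V d) : Prop :=
  AlgebraicIndependent ℚ (fun vi : V × Fin d => p vi.1 vi.2)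

def FrameworkEquiv (G : SimpleGraph V) (p q : Cfg V d) : Prop :=
  ∀ i j, G.Adj i j → dist (p i) (p j) = dist (q i) (q j)

def Congruent (p q : Cfg V d) : Prop :=
  ∃ T : EuclideanSpace ℝ (Fin d) ≃ᵢ EuclideanSpace ℝ (Fin d), ∀ v, q v = T (p v)

def Rigid (G : SimpleGraph V) (p : Cfg V d) : Prop :=
  ∃ U ∈ nhds p, ∀ q ∈ U, FrameworkEquiv G p q → Congruent p q

def IsInfMotion (G : SimpleGraph V) (p p' : Cfg V d) : Prop :=
  ∀ i j, G.Adj i j → ⟪p j - p i, p' j - p' i⟫ = 0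

def IsTrivialMotion (p p' : Cfg V d) : Prop :=
  ∃ (S : Matrix (Fin d) (Fin d) ℝ) (t : Fin d → ℝ),
    S.transpose = -S ∧ ∀ v i, p' v i = (∑ j, S i j * p v j) + t i

def InfRigid (G : SimpleGraph V) (p : Cfg V d) : Prop :=
  ∀ p', IsInfMotion G p p' → IsTrivialMotion p p'

def FiniteMotion (G : SimpleGraph V) (p : Cfg V d) (P : ℝ → Cfg V d) : Prop :=
  ContinuousOn P (Set.Ico 0 1) ∧ P 0 = p ∧
    ∀ t ∈ Set.Ico (0:ℝ) 1, FrameworkEquiv G p (P t)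

def Flexible (G : SimpleGraph V) (p : Cfg V d) : Prop :=
  ∃ P, FiniteMotion G p P ∧ ∃ t ∈ Set.Ico (0:ℝ) 1, ¬ Congruent p (P t)

def IsEquilibriumLoad (p f : Cfg V d) : Prop :=
  (∑ i, f i) = 0 ∧
  ∀ j k : Fin d, j < k → (∑ i, (f i j * p i k - f i k * p i j)) = 0

def Resolves (G : SimpleGraph V) [DecidableRel G.Adj] (p : Cfg V d)
    (ρ : Sym2 V → ℝ) (f : Cfg V d) : Prop :=
  ∀ i, (∑ j, if G.Adj i j then ρ s(i,j) • (p j - p i) else 0) = -f i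

def IsEquilibriumStress (G : SimpleGraph V) [DecidableRel G.Adj] (p : Cfg V d)
    (ω : Sym2 V → ℝ) : Prop :=
  ∀ i, (∑ j, if G.Adj i j then ω s(i,j) • (p j - p i) else 0) = (0 : EuclideanSpace ℝ (Fin d))

/-- The row of the rigidity matrix corresponding to an edge. -/
noncomputable def rRow (p : Cfg V d) : Sym2 V → (V × Fin d → ℝ) :=
  Sym2.lift ⟨fun i j vk =>
      (if vk.1 = i then p i vk.2 - p j vk.2 else 0) +
      (if vk.1 = j then p j vk.2 - p i vk.2 else 0),
    fun _ _ => funext fun _ => add_comm _ _⟩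

noncomputable def coordRow (c : Sym2 V → Option (Fin k)) (p : Cfg V d) (e : Sym2 V) :
    (V × Fin d) ⊕ Fin k → ℝ :=
  Sum.elim (rRow p e) (fun ℓ => if c e = some ℓ then 1 else 0)

noncomputable def rowRank (p : Cfg V d) (F : Set (Sym2 V)) : ℕ :=
  Module.finrank ℝ ↥(Submodule.span ℝ (rRow p '' F))

def CoordEquiv (G : SimpleGraph V) (c : Sym2 V → Option (Fin k))
    (p : Cfg V d) (r : Fin k → ℝ) (q : Cfg V d) (s : Fin k → ℝ) : Prop :=
  (∀ i j, G.Adj i j → c s(i,j) = none → dist (p i) (p j) = dist (q i) (q j)) ∧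
  (∀ i j ℓ, G.Adj i j → c s(i,j) = some ℓ →
    dist (p i) (p j) + r ℓ = dist (q i) (q j) + s ℓ)

def CoordCongruent (G : SimpleGraph V) (c : Sym2 V → Option (Fin k))
    (p : Cfg V d) (r : Fin k → ℝ) (q : Cfg V d) (s : Fin k → ℝ) : Prop :=
  CoordEquiv G c p r q s ∧ Congruent p q

def CoordRigid (G : SimpleGraph V) (c : Sym2 V → Option (Fin k))
    (p : Cfg V d) (r : Fin k → ℝ) : Prop :=
  ∃ U ∈ nhds (p, r), ∀ qs : Cfg V d × (Fin k → ℝ), qs ∈ U →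
    CoordEquiv G c p r qs.1 qs.2 → CoordCongruent G c p r qs.1 qs.2

def IsCoordInfMotion (G : SimpleGraph V) (c : Sym2 V → Option (Fin k))
    (p : Cfg V d) (p' : Cfg V d) (r' : Fin k → ℝ) : Prop :=
  (∀ i j, G.Adj i j → c s(i,j) = none → ⟪p j - p i, p' j - p' i⟫ = 0) ∧
  (∀ i j ℓ, G.Adj i j → c s(i,j) = some ℓ → ⟪p j - p i, p' j - p' i⟫ + r' ℓ = 0)

def CoordInfRigid (G : SimpleGraph V) (c : Sym2 V → Option (Fin k)) (p : Cfg V d) : Prop :=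
  ∀ p' r', IsCoordInfMotion G c p p' r' → r' = 0 ∧ IsTrivialMotion p p'

def CoordFiniteMotion (G : SimpleGraph V) (c : Sym2 V → Option (Fin k))
    (p : Cfg V d) (r : Fin k → ℝ) (P : ℝ → Cfg V d) (R : ℝ → (Fin k → ℝ)) : Prop :=
  ContinuousOn (fun t => (P t, R t)) (Set.Ico 0 1) ∧ P 0 = p ∧ R 0 = r ∧
    ∀ t ∈ Set.Ico (0:ℝ) 1, CoordEquiv G c p r (P t) (R t)

def CoordFlexible (G : SimpleGraph V) (c : Sym2 V → Option (Fin k))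
    (p : Cfg V d) (r : Fin k → ℝ) : Prop :=
  ∃ P R, CoordFiniteMotion G c p r P R ∧
    ∃ t ∈ Set.Ico (0:ℝ) 1, ¬ CoordCongruent G c p r (P t) (R t)

/-- Combinatorial Laman-type notions, for a "subgraph" given by a vertex set `W`
and an edge set `E'`. -/
def support (E' : Set (Sym2 V)) : Set V := {v | ∃ e ∈ E', v ∈ e}

def edgesWithin (E' : Set (Sym2 V)) (W : Set V) : Set (Sym2 V) :=
  {e ∈ E' | ∀ v ∈ e, v ∈ W}

def LamanSparseOn (W : Set V) (E' : Set (Sym2 V)) : Prop :=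
  ∀ W' ⊆ W, 2 ≤ W'.ncard → (edgesWithin E' W').ncard ≤ 2 * W'.ncard - 3

def Sparse22On (W : Set V) (E' : Set (Sym2 V)) : Prop :=
  ∀ W' ⊆ W, 2 ≤ W'.ncard → (edgesWithin E' W').ncard ≤ 2 * W'.ncard - 2

def IsLamanOn (W : Set V) (E' : Set (Sym2 V)) : Prop :=
  LamanSparseOn W E' ∧ E'.ncard = 2 * W.ncard - 3

def IsLamanCircuitOn (W : Set V) (E' : Set (Sym2 V)) : Prop :=
  E'.ncard = 2 * W.ncard - 2 ∧ ∀ e ∈ E', IsLamanOn W (E' \ {e})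

def IsLamanPlusOne (G : SimpleGraph V) : Prop :=
  G.edgeSet.ncard = 2 * Fintype.card V - 2 ∧
    ∃ e ∈ G.edgeSet, IsLamanOn Set.univ (G.edgeSet \ {e})

def IsLamanPlusTwo (G : SimpleGraph V) : Prop :=
  G.edgeSet.ncard = 2 * Fintype.card V - 1 ∧
    ∃ e ∈ G.edgeSet, ∃ f ∈ G.edgeSet, e ≠ f ∧
      IsLamanOn Set.univ (G.edgeSet \ {e, f})

/-- An edge is redundant in the generic `d`-dimensional rigidity matroid of `G`. -/
def RedundantSet (d : ℕ) (G : SimpleGraph V) (F : Set (Sym2 V)) : Prop :=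
  ∀ p : Cfg V d, Generic p → rowRank p (G.edgeSet \ F) = rowRank p G.edgeSet

section Combinatorics

variable {α : Type*} [DecidableEq α]

/-- Laman sparsity of a finite edge set, in subtraction-free form. -/
def LamanSparse (F : Finset (Sym2 α)) : Prop :=
  ∀ W : Finset α, 2 ≤ W.card → (F ∩ W.sym2).card + 3 ≤ 2 * W.card

/-- `W` spans in `F` at least as many edges as a Laman graph on `W` has. -/
def Tight (F : Finset (Sym2 α)) (W : Finset α) : Prop :=
  2 * W.card ≤ (F ∩ W.sym2).card + 3

theorem LamanSparse.mono {F F' : Finset (Sym2 α)} (hF : LamanSparse F) (h : F' ⊆ F) :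
    LamanSparse F' := fun W hW =>
  (Nat.add_le_add_right (Finset.card_le_card (Finset.inter_subset_inter_right h)) 3).trans (hF W hW)

theorem Tight.union {F : Finset (Sym2 α)} (hF : LamanSparse F) {X Y : Finset α}
    (hX : Tight F X) (hY : Tight F Y) (h : 2 ≤ (X ∩ Y).card) : Tight F (X ∪ Y) := by
  have h1 := hF _ h
  have h2 := Finset.card_union_add_card_inter X Y
  have h3 := Finset.card_union_add_card_inter (F ∩ X.sym2) (F ∩ Y.sym2)
  have h4 : (F ∩ X.sym2) ∩ (F ∩ Y.sym2) = F ∩ (X ∩ Y).sym2 := by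
    ext e; simp only [Finset.mem_inter, Finset.mem_sym2_iff]; grind
  have h5 : (F ∩ X.sym2) ∪ (F ∩ Y.sym2) ⊆ F ∩ (X ∪ Y).sym2 := by
    intro e; simp only [Finset.mem_inter, Finset.mem_union, Finset.mem_sym2_iff]; grind
  have h6 := Finset.card_le_card h5
  rw [h4] at h3
  unfold Tight at *
  omega

/-- A loopless edge set has no edge inside a set with at most one vertex. -/
theorem inter_sym2_eq_empty {F : Finset (Sym2 α)} (hF : ∀ e ∈ F, ¬ e.IsDiag) {X : Finset α}
    (hX : X.card ≤ 1) : F ∩ X.sym2 = ∅ := by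
  rw [Finset.eq_empty_iff_forall_notMem]
  intro e he
  rw [Finset.mem_inter] at he
  induction e with
  | _ a b =>
    rw [Finset.mk_mem_sym2_iff] at he
    exact hF _ he.1 (Finset.card_le_one.1 hX a he.2.1 b he.2.2)

theorem disjoint_inter_sym2 {F : Finset (Sym2 α)} (hF : ∀ e ∈ F, ¬ e.IsDiag) {X Y : Finset α}
    (h : (X ∩ Y).card ≤ 1) : Disjoint (F ∩ X.sym2) (F ∩ Y.sym2) := by
  rw [Finset.disjoint_iff_inter_eq_empty, ← inter_sym2_eq_empty hF h]
  ext e; simp only [Finset.mem_inter, Finset.mem_sym2_iff]; grind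

theorem Tight.union₃ {F : Finset (Sym2 α)} (hF : ∀ e ∈ F, ¬ e.IsDiag) {X Y Z : Finset α}
    (hX : Tight F X) (hY : Tight F Y) (hZ : Tight F Z) {a b c : α} (hac : a ≠ c)
    (haX : a ∈ X) (hbX : b ∈ X) (hbY : b ∈ Y) (hcY : c ∈ Y) (haZ : a ∈ Z) (hcZ : c ∈ Z)
    (hXY : (X ∩ Y).card ≤ 1) (hYZ : (Y ∩ Z).card ≤ 1) (hXZ : (X ∩ Z).card ≤ 1) :
    Tight F (X ∪ Y ∪ Z) := by
  have h1 := Finset.card_union_add_card_inter X Y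
  have h2 := Finset.card_union_add_card_inter (X ∪ Y) Z
  have h3 : 1 ≤ (X ∩ Y).card := Finset.card_pos.2 ⟨b, Finset.mem_inter.2 ⟨hbX, hbY⟩⟩
  have h4 : 2 ≤ ((X ∪ Y) ∩ Z).card := by
    rw [← Finset.card_pair hac]
    apply Finset.card_le_card
    intro x; simp only [Finset.mem_insert, Finset.mem_singleton, Finset.mem_inter, Finset.mem_union]
    grind
  have h5 := Finset.card_union_of_disjoint (disjoint_inter_sym2 hF hXY)
  have h6 := Finset.card_union_of_disjoint
    (Finset.disjoint_union_left.2 ⟨disjoint_inter_sym2 hF hXZ, disjoint_inter_sym2 hF hYZ⟩)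
  have h7 : (F ∩ X.sym2) ∪ (F ∩ Y.sym2) ∪ (F ∩ Z.sym2) ⊆ F ∩ (X ∪ Y ∪ Z).sym2 := by
    intro e; simp only [Finset.mem_inter, Finset.mem_union, Finset.mem_sym2_iff]; grind
  have h8 := Finset.card_le_card h7
  unfold Tight at *
  omega

/-- If adding the edge `ab` to a sparse set is impossible, a tight set containing `a` and `b`
is the obstruction; it can be chosen to avoid any prescribed uncovered vertex. -/
theorem exists_tight_of_not_insert {F : Finset (Sym2 α)} (hF : LamanSparse F) {v a b : α}
    (hv : ∀ e ∈ F, v ∉ e) (hva : v ≠ a) (hvb : v ≠ b) (hab : a ≠ b)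
    (h : ¬ (s(a, b) ∉ F ∧ LamanSparse (insert s(a, b) F))) :
    ∃ T, Tight F T ∧ v ∉ T ∧ a ∈ T ∧ b ∈ T := by
  by_cases hmem : s(a, b) ∈ F
  · refine ⟨{a, b}, ?_, by simp [hva, hvb], by simp, by simp⟩
    have : 1 ≤ (F ∩ ({a, b} : Finset α).sym2).card :=
      Finset.card_pos.2 ⟨s(a, b), by simp [hmem]⟩
    unfold Tight
    rw [Finset.card_pair hab]
    omega
  · have h' : ¬ LamanSparse (insert s(a, b) F) := fun h' => h ⟨hmem, h'⟩
    unfold LamanSparse at h'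
    push Not at h'
    obtain ⟨W, hW, hlt⟩ := h'
    by_cases hs : s(a, b) ∈ W.sym2
    · rw [Finset.insert_inter_of_mem hs] at hlt
      have h1 := Finset.card_insert_le s(a, b) (F ∩ W.sym2)
      have h2 : F ∩ (W.erase v).sym2 = F ∩ W.sym2 := by
        ext e; simp only [Finset.mem_inter, Finset.mem_sym2_iff, Finset.mem_erase]; grind
      rw [Finset.mk_mem_sym2_iff] at hs
      refine ⟨W.erase v, ?_, by simp, by simp [hs.1, hva.symm], by simp [hs.2, hvb.symm]⟩
      unfold Tight
      rw [h2]
      have := Finset.card_erase_le (s := W) (a := v)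
      omega
    · rw [Finset.insert_inter_of_notMem hs] at hlt
      have := hF W hW
      omega

/-- The inverse of Henneberg's 1-extension: a sparse set stays sparse when a vertex of degree
three is replaced by a suitable edge between two of its neighbours. -/
theorem exists_insert_sparse {F : Finset (Sym2 α)} (hd : ∀ e ∈ F, ¬ e.IsDiag) {v a b c : α}
    (hv : ∀ e ∈ F, v ∉ e) (hva : v ≠ a) (hvb : v ≠ b) (hvc : v ≠ c)
    (hab : a ≠ b) (hac : a ≠ c) (hbc : b ≠ c)
    (h : LamanSparse (F ∪ {s(v, a), s(v, b), s(v, c)})) :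
    (s(a, b) ∉ F ∧ LamanSparse (insert s(a, b) F)) ∨
    (s(b, c) ∉ F ∧ LamanSparse (insert s(b, c) F)) ∨
    (s(a, c) ∉ F ∧ LamanSparse (insert s(a, c) F)) := by
  have hF : LamanSparse F := h.mono Finset.subset_union_left
  have key : ∀ T, Tight F T → v ∉ T → a ∈ T → b ∈ T → c ∈ T → False := by
    intro T hT hvT haT hbT hcT
    have h1 := h (insert v T) (by
      rw [← Finset.card_pair hva]; exact Finset.card_le_card (by grind))
    have hsub : (F ∩ T.sym2) ∪ {s(v, a), s(v, b), s(v, c)} ⊆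
        (F ∪ {s(v, a), s(v, b), s(v, c)}) ∩ (insert v T).sym2 := by
      intro e
      simp only [Finset.mem_inter, Finset.mem_union, Finset.mem_insert, Finset.mem_singleton]
      rintro (⟨h1, h2⟩ | rfl | rfl | rfl)
      · exact ⟨Or.inl h1, Finset.sym2_mono (Finset.subset_insert _ _) h2⟩
      all_goals simp [*]
    have h2 := Finset.card_le_card hsub
    have hdis : Disjoint (F ∩ T.sym2) {s(v, a), s(v, b), s(v, c)} := by
      rw [Finset.disjoint_left]
      intro e he h'
      have := hv e (Finset.mem_inter.1 he).1
      simp only [Finset.mem_insert, Finset.mem_singleton] at h'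
      rcases h' with rfl | rfl | rfl <;> simp at this
    have h3 : ({s(v, a), s(v, b), s(v, c)} : Finset (Sym2 α)).card = 3 := by
      rw [Finset.card_eq_three]
      exact ⟨_, _, _, by simp [hab, hva.symm], by simp [hac, hva.symm],
        by simp [hbc, hvb.symm], rfl⟩
    rw [Finset.card_union_of_disjoint hdis, h3] at h2
    rw [Finset.card_insert_of_notMem hvT] at h1
    unfold Tight at hT
    omega
  by_contra hcon
  push Not at hcon
  obtain ⟨X, hX, hvX, haX, hbX⟩ := exists_tight_of_not_insert hF hv hva hvb hab (by tauto)
  obtain ⟨Y, hY, hvY, hbY, hcY⟩ := exists_tight_of_not_insert hF hv hvb hvc hbc (by tauto)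
  obtain ⟨Z, hZ, hvZ, haZ, hcZ⟩ := exists_tight_of_not_insert hF hv hva hvc hac (by tauto)
  have hXY : (X ∩ Y).card ≤ 1 := by
    by_contra! hlt
    exact key _ (hX.union hF hY hlt) (by simp [hvX, hvY]) (by simp [haX]) (by simp [hbX])
      (by simp [hcY])
  have hYZ : (Y ∩ Z).card ≤ 1 := by
    by_contra! hlt
    exact key _ (hY.union hF hZ hlt) (by simp [hvY, hvZ]) (by simp [haZ]) (by simp [hbY])
      (by simp [hcY])
  have hXZ : (X ∩ Z).card ≤ 1 := by
    by_contra! hlt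
    exact key _ (hX.union hF hZ hlt) (by simp [hvX, hvZ]) (by simp [haX]) (by simp [hbX])
      (by simp [hcZ])
  exact key _ (Tight.union₃ hd hX hY hZ hac haX hbX hbY hcY haZ hcZ hXY hYZ hXZ)
    (by simp [hvX, hvY, hvZ]) (by simp [haX]) (by simp [hbX]) (by simp [hcY])

/-- A nonempty loopless sparse edge set has a covered vertex of degree at most three. -/
theorem LamanSparse.exists_degree_le_three {F : Finset (Sym2 α)} (hF : LamanSparse F)
    (hd : ∀ e ∈ F, ¬ e.IsDiag) (hne : F.Nonempty) :
    ∃ v, 1 ≤ (F.filter (v ∈ ·)).card ∧ (F.filter (v ∈ ·)).card ≤ 3 := by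
  by_contra! hcon
  let W := F.biUnion Sym2.toFinset
  have hsum : ∑ v ∈ W, (F.filter (v ∈ ·)).card = ∑ e ∈ F, (W.filter (· ∈ e)).card :=
    Finset.sum_card_bipartiteAbove_eq_sum_card_bipartiteBelow (fun v e => v ∈ e)
  have h1 : ∑ e ∈ F, (W.filter (· ∈ e)).card = ∑ e ∈ F, 2 := by
    refine Finset.sum_congr rfl fun e he => ?_
    rw [← Sym2.card_toFinset_of_not_isDiag e (hd e he)]
    congr 1
    ext x
    simp only [W, Finset.mem_filter, Finset.mem_biUnion, Sym2.mem_toFinset]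
    grind
  have h2 : ∑ v ∈ W, 4 ≤ ∑ v ∈ W, (F.filter (v ∈ ·)).card := by
    refine Finset.sum_le_sum fun v hv => hcon v ?_
    obtain ⟨e, he, hve⟩ := Finset.mem_biUnion.1 hv
    exact Finset.card_pos.2 ⟨e, by simpa using ⟨he, Sym2.mem_toFinset.1 hve⟩⟩
  obtain ⟨e, he⟩ := hne
  have h3 : 2 ≤ W.card := by
    rw [← Sym2.card_toFinset_of_not_isDiag e (hd e he)]
    exact Finset.card_le_card (Finset.subset_biUnion_of_mem Sym2.toFinset he)
  have h4 : F ∩ W.sym2 = F := Finset.inter_eq_left.2 fun e he =>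
    Finset.mem_sym2_iff.2 fun a ha =>
      Finset.mem_biUnion.2 ⟨e, he, Sym2.mem_toFinset.2 ha⟩
  have h5 := hF W h3
  rw [h4] at h5
  rw [hsum, h1] at h2
  simp only [Finset.sum_const, smul_eq_mul] at h2
  omega

end Combinatorics
section Rigidity

variable {α : Type*} [DecidableEq α]

theorem rRow_mk (p : Cfg α d) (i j w : α) (l : Fin d) :
    rRow p s(i, j) (w, l) =
      (if w = i then p i l - p j l else 0) + (if w = j then p j l - p i l else 0) := rfl

theorem rRow_apply_of_notMem (p : Cfg α d) {e : Sym2 α} {v : α} (h : v ∉ e) (l : Fin d) :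
    rRow p e (v, l) = 0 := by
  induction e with
  | _ a b =>
    rw [Sym2.mem_iff, not_or] at h
    simp [rRow_mk, h.1, h.2]

theorem rRow_update_of_notMem (p : Cfg α d) {e : Sym2 α} {v : α} (h : v ∉ e)
    (x : EuclideanSpace ℝ (Fin d)) : rRow (Function.update p v x) e = rRow p e := by
  induction e with
  | _ a b =>
    rw [Sym2.mem_iff, not_or] at h
    ext ⟨w, l⟩
    simp [rRow_mk, Ne.symm h.1, Ne.symm h.2]

theorem rRow_mk_apply_left (p : Cfg α d) {v a : α} (h : v ≠ a) (l : Fin d) :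
    rRow p s(v, a) (v, l) = p v l - p a l := by
  simp [rRow_mk, h]

theorem apply_eq_zero_of_mem_span (p : Cfg α d) {F : Set (Sym2 α)} {v : α}
    (hv : ∀ e ∈ F, v ∉ e) {x : α × Fin d → ℝ} (hx : x ∈ Submodule.span ℝ (rRow p '' F))
    (l : Fin d) : x (v, l) = 0 := by
  have : Submodule.span ℝ (rRow p '' F) ≤
      LinearMap.ker (LinearMap.proj (R := ℝ) (φ := fun _ : α × Fin d => ℝ) (v, l)) := by
    rw [Submodule.span_le]
    rintro _ ⟨e, he, rfl⟩
    simpa using rRow_apply_of_notMem p (hv e he) l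
  simpa using this hx

theorem linearIndepOn_insert_pendant (p : Cfg α 2) {F : Set (Sym2 α)}
    (hF : LinearIndepOn ℝ (rRow p) F) {v a : α} (hv : ∀ e ∈ F, v ∉ e) (hva : v ≠ a)
    (l : Fin 2) (hp : p v l ≠ p a l) : LinearIndepOn ℝ (rRow p) (insert s(v, a) F) := by
  refine hF.insert fun hmem => ?_
  have := apply_eq_zero_of_mem_span p hv hmem l
  rw [rRow_mk_apply_left p hva] at this
  exact hp (sub_eq_zero.1 this)

/-- Twice the signed area of the triangle `p u`, `p a`, `p b`. -/
def area (p : Cfg α 2) (u a b : α) : ℝ :=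
  (p u 0 - p a 0) * (p u 1 - p b 1) - (p u 1 - p a 1) * (p u 0 - p b 0)

theorem linearIndepOn_insert_insert (p : Cfg α 2) {F : Set (Sym2 α)}
    (hF : LinearIndepOn ℝ (rRow p) F) {v a b : α} (hv : ∀ e ∈ F, v ∉ e) (hva : v ≠ a)
    (hvb : v ≠ b) (hp : area p v a b ≠ 0) :
    LinearIndepOn ℝ (rRow p) (insert s(v, a) (insert s(v, b) F)) := by
  have hb : LinearIndepOn ℝ (rRow p) (insert s(v, b) F) := by
    by_cases h0 : p v 0 = p b 0
    · refine linearIndepOn_insert_pendant p hF hv hvb 1 fun h1 => hp ?_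
      simp [area, h0, h1]
    · exact linearIndepOn_insert_pendant p hF hv hvb 0 h0
  refine hb.insert fun hmem => hp ?_
  rw [Set.image_insert_eq, Submodule.mem_span_insert] at hmem
  obtain ⟨c, z, hz, heq⟩ := hmem
  have h (l : Fin 2) : p v l - p a l = c * (p v l - p b l) := by
    have := congrFun heq (v, l)
    simpa [rRow_mk_apply_left p hva, rRow_mk_apply_left p hvb,
      apply_eq_zero_of_mem_span p hv hz l] using this
  rw [area, h 0, h 1]
  ring

/-- The row of the rigidity matrix of an indeterminate configuration. -/
noncomputable def rowPoly : Sym2 α → (α × Fin d → MvPolynomial (α × Fin d) ℚ) :=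
  Sym2.lift ⟨fun i j vk =>
      (if vk.1 = i then MvPolynomial.X (i, vk.2) - MvPolynomial.X (j, vk.2) else 0) +
      (if vk.1 = j then MvPolynomial.X (j, vk.2) - MvPolynomial.X (i, vk.2) else 0),
    fun _ _ => funext fun _ => add_comm _ _⟩

theorem aeval_rowPoly (p : Cfg α d) (e : Sym2 α) (x : α × Fin d) :
    MvPolynomial.aeval (fun vi : α × Fin d => p vi.1 vi.2) (rowPoly e x) = rRow p e x := by
  induction e with
  | _ a b =>
    simp only [rowPoly, rRow, Sym2.lift_mk, map_add]
    split_ifs <;> simp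

theorem Generic.aeval_ne_zero {β : Type*} {p : Cfg β d} (hp : Generic p) (q : Cfg β d)
    (f : MvPolynomial (β × Fin d) ℚ)
    (hf : MvPolynomial.aeval (fun vi : β × Fin d => q vi.1 vi.2) f ≠ 0) :
    MvPolynomial.aeval (fun vi : β × Fin d => p vi.1 vi.2) f ≠ 0 := by
  intro h
  have := (injective_iff_map_eq_zero _).1 hp f h
  simp [this] at hf

/-- The rows of a real matrix are independent iff its Gram determinant is nonzero. -/
theorem linearIndependent_iff_det_mul_transpose_ne_zero {m n : Type*} [Fintype m] [DecidableEq m]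
    [Fintype n] (A : Matrix m n ℝ) : LinearIndependent ℝ A.row ↔ (A * A.transpose).det ≠ 0 := by
  rw [← Matrix.vecMul_injective_iff, ← not_iff_not, not_not, ← Matrix.exists_vecMul_eq_zero_iff]
  have h (x : m → ℝ) : Matrix.vecMul x (A * A.transpose) = 0 ↔ Matrix.vecMul x A = 0 := by
    have := Matrix.vecMul_self_mul_conjTranspose_eq_zero A x
    rwa [Matrix.conjTranspose_eq_transpose_of_trivial] at this
  simp only [h]
  have := injective_iff_map_eq_zero A.vecMulLinear
  simp only [Matrix.coe_vecMulLinear, Matrix.vecMulLinear_apply] at this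
  rw [this]
  push Not
  simp only [and_comm]

/-- Row independence at some configuration implies it at every generic configuration. -/
theorem Generic.linearIndepOn [Fintype α] {p : Cfg α d} (hp : Generic p) (q : Cfg α d)
    (F : Finset (Sym2 α)) (hq : LinearIndepOn ℝ (rRow q) (F : Set (Sym2 α))) :
    LinearIndepOn ℝ (rRow p) (F : Set (Sym2 α)) := by
  let A : Matrix F (α × Fin d) (MvPolynomial (α × Fin d) ℚ) := Matrix.of fun e => rowPoly e.1
  have key (r : Cfg α d) : LinearIndepOn ℝ (rRow r) (F : Set (Sym2 α)) ↔
      MvPolynomial.aeval (fun vi : α × Fin d => r vi.1 vi.2) (A * A.transpose).det ≠ 0 := by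
    have hA : A.map (MvPolynomial.aeval (fun vi : α × Fin d => r vi.1 vi.2)) =
        Matrix.of fun e : F => rRow r e.1 := by
      ext e x
      exact aeval_rowPoly r e.1 x
    rw [AlgHom.map_det, AlgHom.mapMatrix_apply, Matrix.map_mul, Matrix.transpose_map, hA,
      ← linearIndependent_iff_det_mul_transpose_ne_zero]
    rfl
  rw [key] at hq ⊢
  exact hp.aeval_ne_zero q _ hq

theorem Generic.area_ne_zero {p : Cfg α 2} (hp : Generic p) {a b c : α} (hab : a ≠ b)
    (hac : a ≠ c) (hbc : b ≠ c) : area p a b c ≠ 0 := by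
  let f : MvPolynomial (α × Fin 2) ℚ :=
    (.X (a, 0) - .X (b, 0)) * (.X (a, 1) - .X (c, 1)) -
      (.X (a, 1) - .X (b, 1)) * (.X (a, 0) - .X (c, 0))
  have hf (q : Cfg α 2) :
      MvPolynomial.aeval (fun vi : α × Fin 2 => q vi.1 vi.2) f = area q a b c := by
    simp [f, area]
  let q : Cfg α 2 := fun u => if u = b then !₂[1, 0] else if u = c then !₂[0, 1] else !₂[0, 0]
  have := hp.aeval_ne_zero q f (by rw [hf]; simp [area, q, hab, hac, hbc.symm])
  rwa [hf] at this

theorem Generic.apply_ne {β : Type*} {p : Cfg β d} (hp : Generic p) {a b : β} (hab : a ≠ b)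
    (l : Fin d) : p a l ≠ p b l := fun h => by
  have := AlgebraicIndependent.injective hp (a₁ := (a, l)) (a₂ := (b, l)) h
  simp [hab] at this

/-- Henneberg's 1-extension preserves row independence at a generic configuration. -/
theorem Generic.linearIndepOn_one_extension [Fintype α] {p : Cfg α 2} (hp : Generic p)
    {F : Finset (Sym2 α)} {v a b c : α} (hv : ∀ e ∈ F, v ∉ e)
    (hva : v ≠ a) (hvb : v ≠ b) (hvc : v ≠ c) (hab : a ≠ b) (hac : a ≠ c) (hbc : b ≠ c)
    (hmem : s(a, b) ∉ F)
    (h : LinearIndepOn ℝ (rRow p) (insert s(a, b) F : Finset (Sym2 α))) :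
    LinearIndepOn ℝ (rRow p) (F ∪ {s(v, a), s(v, b), s(v, c)} : Finset (Sym2 α)) := by
  let q : Cfg α 2 := Function.update p v ((1 / 2 : ℝ) • (p a + p b))
  refine hp.linearIndepOn q _ ?_
  have hvab : v ∉ s(a, b) := by simp [hva, hvb]
  have hv' : ∀ e ∈ (insert s(a, b) F : Set (Sym2 α)), v ∉ e := by
    rintro e (rfl | he)
    exacts [hvab, hv e he]
  rw [Finset.coe_insert] at h
  have hq : LinearIndepOn ℝ (rRow q) (insert s(a, b) (F : Set (Sym2 α))) :=
    h.congr fun e he => (rRow_update_of_notMem p (hv' e he) _).symm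
  have harea : area q v a c ≠ 0 := by
    have h1 : area q v a c = -(1 / 2) * area p a b c := by
      simp [area, q, hva.symm, hvc.symm]
      ring
    rw [h1]
    exact mul_ne_zero (by norm_num) (hp.area_ne_zero hab hac hbc)
  have h3 := linearIndepOn_insert_insert q hq hv' hva hvc harea
  have hset : insert s(v, a) (insert s(v, c) (insert s(a, b) (F : Set (Sym2 α)))) =
      insert s(a, b) (insert s(v, a) (insert s(v, c) (F : Set (Sym2 α)))) := by
    ext; simp only [Set.mem_insert_iff]; tauto
  rw [hset] at h3
  have hnot : s(a, b) ∉ insert s(v, a) (insert s(v, c) (F : Set (Sym2 α))) := by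
    rintro (h | h | h)
    · rw [h] at hvab; simp at hvab
    · rw [h] at hvab; simp at hvab
    · exact hmem h
  rw [linearIndepOn_insert hnot] at h3
  have hrow : rRow q s(a, b) = (2 : ℝ) • (rRow q s(v, a) + rRow q s(v, b)) := by
    ext ⟨w, l⟩
    by_cases hwv : w = v
    · subst hwv
      simp [rRow_mk, q, hva, hvb, hva.symm, hvb.symm]
      ring
    · by_cases hwa : w = a
      · subst hwa
        simp [rRow_mk, q, hwv, hab, hvb.symm]
        ring
      · by_cases hwb : w = b
        · subst hwb
          simp [rRow_mk, q, hwv, hwa, hva.symm]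
          ring
        · simp [rRow_mk, hwv, hwa, hwb]
  have h4 : LinearIndepOn ℝ (rRow q)
      (insert s(v, b) (insert s(v, a) (insert s(v, c) (F : Set (Sym2 α))))) := by
    refine h3.1.insert fun hb => h3.2 ?_
    rw [hrow]
    refine Submodule.smul_mem _ _ (Submodule.add_mem _ ?_ hb)
    exact Submodule.subset_span ⟨_, Set.mem_insert _ _, rfl⟩
  convert h4 using 1
  ext
  simp only [Finset.coe_union, Finset.coe_insert, Finset.coe_singleton, Set.mem_union,
    Set.mem_insert_iff, Set.mem_singleton_iff]
  tauto

/-- The Pollaczek-Geiringer-Laman theorem: the rows of a loopless Laman-sparse edge set are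
independent at every generic configuration. -/
theorem Generic.linearIndepOn_of_lamanSparse [Fintype α] {p : Cfg α 2} (hp : Generic p)
    (F : Finset (Sym2 α)) (hd : ∀ e ∈ F, ¬ e.IsDiag) (hF : LamanSparse F) :
    LinearIndepOn ℝ (rRow p) (F : Set (Sym2 α)) := by
  induction hn : F.card using Nat.strong_induction_on generalizing F with
  | _ n ih =>
  rcases F.eq_empty_or_nonempty with rfl | hne
  · simp
  obtain ⟨v, h1, h3⟩ := hF.exists_degree_le_three hd hne
  set D := F.filter (v ∈ ·) with hD
  set E := F.filter (v ∉ ·) with hE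
  have hsplit : F = E ∪ D := by rw [Finset.union_comm, Finset.filter_union_filter_not_eq]
  have hcard : E.card + D.card = F.card := by
    rw [add_comm]; exact Finset.card_filter_add_card_filter_not _
  have hEF : E ⊆ F := Finset.filter_subset _ _
  have hvE : ∀ e ∈ E, v ∉ e := fun e he => (Finset.mem_filter.1 he).2
  have hdE : ∀ e ∈ E, ¬ e.IsDiag := fun e he => hd e (hEF he)
  have hvE' : ∀ e ∈ (E : Set (Sym2 α)), v ∉ e := hvE
  have hDform : ∀ e ∈ D, ∃ a, v ≠ a ∧ e = s(v, a) := by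
    intro e he
    obtain ⟨heF, a, rfl⟩ := Finset.mem_filter.1 he
    exact ⟨a, fun h => hd _ heF (by simp [h]), rfl⟩
  have ihE : LinearIndepOn ℝ (rRow p) (E : Set (Sym2 α)) :=
    ih E.card (by omega) E hdE (hF.mono hEF) rfl
  have hcases : D.card = 1 ∨ D.card = 2 ∨ D.card = 3 := by omega
  rcases hcases with hc | hc | hc
  · obtain ⟨e, he⟩ := Finset.card_eq_one.1 hc
    obtain ⟨a, hva, rfl⟩ := hDform e (by simp [he])
    have := linearIndepOn_insert_pendant p ihE hvE' hva 0 (hp.apply_ne hva 0)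
    rw [hsplit, he]
    convert this using 1
    simp
  · obtain ⟨e, f, hef, he⟩ := Finset.card_eq_two.1 hc
    obtain ⟨a, hva, rfl⟩ := hDform e (by simp [he])
    obtain ⟨b, hvb, rfl⟩ := hDform f (by simp [he])
    have hab : a ≠ b := fun h => hef (by rw [h])
    have := linearIndepOn_insert_insert p ihE hvE' hva hvb (hp.area_ne_zero hva hvb hab)
    rw [hsplit, he]
    convert this using 1
    ext; simp
  · obtain ⟨e, f, g, hef, heg, hfg, he⟩ := Finset.card_eq_three.1 hc
    obtain ⟨a, hva, rfl⟩ := hDform e (by simp [he])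
    obtain ⟨b, hvb, rfl⟩ := hDform f (by simp [he])
    obtain ⟨c, hvc, rfl⟩ := hDform g (by simp [he])
    have hab : a ≠ b := fun h => hef (by rw [h])
    have hac : a ≠ c := fun h => heg (by rw [h])
    have hbc : b ≠ c := fun h => hfg (by rw [h])
    have ihI {x y : α} (hxy : x ≠ y) (hmem : s(x, y) ∉ E)
        (hs : LamanSparse (insert s(x, y) E)) :
        LinearIndepOn ℝ (rRow p) (insert s(x, y) E : Finset (Sym2 α)) := by
      refine ih _ ?_ _ ?_ hs rfl
      · rw [Finset.card_insert_of_notMem hmem]; omega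
      · intro e he
        rcases Finset.mem_insert.1 he with rfl | he
        exacts [by simpa using hxy, hdE e he]
    rw [hsplit, he]
    rcases exists_insert_sparse hdE hvE hva hvb hvc hab hac hbc
      (by rw [← he, ← hsplit]; exact hF) with ⟨hm, hs⟩ | ⟨hm, hs⟩ | ⟨hm, hs⟩
    · exact hp.linearIndepOn_one_extension hvE hva hvb hvc hab hac hbc hm (ihI hab hm hs)
    · have hperm : ({s(v, a), s(v, b), s(v, c)} : Finset (Sym2 α)) =
          {s(v, b), s(v, c), s(v, a)} := by
        ext; simp only [Finset.mem_insert, Finset.mem_singleton]; tauto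
      rw [hperm]
      exact hp.linearIndepOn_one_extension hvE hvb hvc hva hbc hab.symm hac.symm hm
        (ihI hbc hm hs)
    · have hperm : ({s(v, a), s(v, b), s(v, c)} : Finset (Sym2 α)) =
          {s(v, a), s(v, c), s(v, b)} := by
        ext; simp only [Finset.mem_insert, Finset.mem_singleton]; tauto
      rw [hperm]
      exact hp.linearIndepOn_one_extension hvE hva hvc hvb hac hab hbc.symm hm
        (ihI hac hm hs)

/-- The rows of edges inside `W` are supported on `W` and resolve to equilibrium loads. -/
theorem equilibrium_of_mem_span [Fintype α] (p : Cfg α 2) {F : Set (Sym2 α)} {W : Finset α}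
    (hW : ∀ e ∈ F, ∀ v ∈ e, v ∈ W) {x : α × Fin 2 → ℝ}
    (hx : x ∈ Submodule.span ℝ (rRow p '' F)) :
    (∀ v ∉ W, ∀ l, x (v, l) = 0) ∧ (∀ l, ∑ v, x (v, l) = 0) ∧
      ∑ v, (x (v, 0) * p v 1 - x (v, 1) * p v 0) = 0 := by
  refine ⟨fun v hv l => apply_eq_zero_of_mem_span p (fun e he hve => hv (hW e he v hve)) hx l, ?_⟩
  induction hx using Submodule.span_induction with
  | mem x hx =>
    obtain ⟨e, -, rfl⟩ := hx
    induction e with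
    | _ a b =>
      simp only [rRow_mk, Finset.sum_add_distrib, Finset.sum_sub_distrib, add_mul, ite_mul,
        zero_mul, Finset.sum_ite_eq', Finset.mem_univ, if_true]
      exact ⟨fun l => by ring, by ring⟩
  | zero => simp
  | add x y _ _ hx hy =>
    refine ⟨fun l => by simp [Finset.sum_add_distrib, hx.1 l, hy.1 l], ?_⟩
    have hxy := congrArg₂ (· + ·) hx.2 hy.2
    simp only [← Finset.sum_add_distrib, add_zero] at hxy
    rw [← hxy]
    exact Finset.sum_congr rfl fun v _ => by simp; ring
  | smul c x _ hx =>
    refine ⟨fun l => by simp [← Finset.mul_sum, hx.1 l], ?_⟩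
    rw [← mul_zero c, ← hx.2, Finset.mul_sum]
    exact Finset.sum_congr rfl fun v _ => by simp; ring

/-- Independence of the rows at a generic configuration forces Laman sparsity. -/
theorem Generic.lamanSparse_of_linearIndepOn [Fintype α] {p : Cfg α 2} (hp : Generic p)
    {F : Finset (Sym2 α)} (hF : LinearIndepOn ℝ (rRow p) (F : Set (Sym2 α))) :
    LamanSparse F := by
  intro W hW
  obtain ⟨a, ha, b, hb, hab⟩ := Finset.one_lt_card.1 hW
  let R : Finset (α × Fin 2) := {(a, 0), (a, 1), (b, 1)}
  let T : Finset (α × Fin 2) := (W ×ˢ Finset.univ) \ R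
  have hR : R.card = 3 :=
    Finset.card_eq_three.2 ⟨_, _, _, by simp, by simp [hab], by simp [hab], rfl⟩
  have hT : T.card + 3 = 2 * W.card := by
    have h1 : R ⊆ W ×ˢ Finset.univ := by
      intro x
      simp only [R, Finset.mem_insert, Finset.mem_singleton, Finset.mem_product]
      rintro (rfl | rfl | rfl) <;> simp [ha, hb]
    have h2 := Finset.card_sdiff_add_card_eq_card h1
    rw [hR, Finset.card_product, Finset.card_univ, Fintype.card_fin] at h2
    simp only [T]
    omega
  rw [← hT]
  refine Nat.add_le_add_right ?_ 3
  let E := F ∩ W.sym2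
  have hE : LinearIndependent ℝ (fun e : E => rRow p e.1) :=
    LinearIndepOn.mono hF (Finset.coe_subset.2 (Finset.inter_subset_left : E ⊆ F))
  have hdisj : Disjoint (Submodule.span ℝ (Set.range fun e : E => rRow p e.1))
      (LinearMap.ker (LinearMap.funLeft ℝ ℝ (Subtype.val : T → α × Fin 2))) := by
    rw [Submodule.disjoint_def]
    intro x hx hker
    have hx' : x ∈ Submodule.span ℝ (rRow p '' (E : Set (Sym2 α))) := by
      rwa [Set.image_eq_range]
    obtain ⟨hsupp, hsum, hmom⟩ := equilibrium_of_mem_span p (W := W)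
      (fun e he => Finset.mem_sym2_iff.1 (Finset.mem_inter.1 he).2) hx'
    have hzero : ∀ z, z ∉ R → x z = 0 := by
      rintro ⟨v, l⟩ hz
      by_cases hv : v ∈ W
      · exact congrFun (LinearMap.mem_ker.1 hker) ⟨(v, l), by simp [T, hv, hz]⟩
      · exact hsupp v hv l
    have ha0 : x (a, 0) = 0 := by
      rw [← hsum 0, Finset.sum_eq_single a (fun v _ hv => hzero _ (by simp [R, hv])) (by simp)]
    have hx0 : ∀ v, x (v, 0) = 0 := fun v => by
      by_cases hv : v = a
      · rw [hv, ha0]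
      · exact hzero _ (by simp [R, hv])
    have h1 : x (a, 1) + x (b, 1) = 0 := by
      rw [← hsum 1, Fintype.sum_eq_add a b hab fun v hv => hzero _ (by simp [R, hv])]
    have h2 : x (a, 1) * p a 0 + x (b, 1) * p b 0 = 0 := by
      rw [Fintype.sum_eq_add a b hab fun v hv => by
        simp [hx0, hzero (v, 1) (by simp [R, hv])]] at hmom
      simp only [hx0] at hmom
      linarith
    have ha1 : x (a, 1) = 0 := by
      have h3 : x (a, 1) * (p a 0 - p b 0) = 0 := by linear_combination h2 - p b 0 * h1
      exact (mul_eq_zero.1 h3).resolve_right (sub_ne_zero.2 (hp.apply_ne hab 0))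
    have hb1 : x (b, 1) = 0 := by linarith
    funext z
    by_cases hz : z ∈ R
    · simp only [R, Finset.mem_insert, Finset.mem_singleton] at hz
      rcases hz with rfl | rfl | rfl
      exacts [ha0, ha1, hb1]
    · exact hzero z hz
  have := (hE.map hdisj).fintype_card_le_finrank
  rwa [Fintype.card_coe, Module.finrank_fintype_fun_eq_card, Fintype.card_coe] at this

theorem Generic.linearIndepOn_iff_lamanSparse [Fintype α] {p : Cfg α 2} (hp : Generic p)
    {F : Finset (Sym2 α)} (hd : ∀ e ∈ F, ¬ e.IsDiag) :
    LinearIndepOn ℝ (rRow p) (F : Set (Sym2 α)) ↔ LamanSparse F :=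
  ⟨hp.lamanSparse_of_linearIndepOn, hp.linearIndepOn_of_lamanSparse F hd⟩

theorem linearIndepOn_iff_card_le_rowRank (p : Cfg α d) (F : Finset (Sym2 α)) :
    LinearIndepOn ℝ (rRow p) (F : Set (Sym2 α)) ↔ F.card ≤ rowRank p F := by
  rw [rowRank, Set.image_eq_range, ← Fintype.card_coe F]
  exact linearIndependent_iff_card_le_finrank_span

theorem rowRank_mono [Fintype α] (p : Cfg α d) {E F : Set (Sym2 α)} (h : E ⊆ F) :
    rowRank p E ≤ rowRank p F :=
  Submodule.finrank_mono (Submodule.span_mono (Set.image_mono h))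

theorem rowRank_diff_singleton_eq (p : Cfg α d) {F : Set (Sym2 α)} {e : Sym2 α}
    (h : rRow p e ∈ Submodule.span ℝ (rRow p '' (F \ {e}))) :
    rowRank p (F \ {e}) = rowRank p F := by
  have : Submodule.span ℝ (rRow p '' (F \ {e})) = Submodule.span ℝ (rRow p '' F) := by
    refine le_antisymm (Submodule.span_mono (Set.image_mono Set.sdiff_subset)) ?_
    rw [Submodule.span_le]
    rintro _ ⟨f, hf, rfl⟩
    by_cases hfe : f = e
    · rwa [hfe]
    · exact Submodule.subset_span ⟨f, ⟨hf, hfe⟩, rfl⟩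
  rw [rowRank, this, rowRank]

end Rigidity

section Circuits

variable {α : Type*} [DecidableEq α]

theorem edgesWithin_coe (F : Finset (Sym2 α)) (W : Finset α) :
    edgesWithin (F : Set (Sym2 α)) (W : Set α) = ((F ∩ W.sym2 : Finset (Sym2 α)) : Set _) := by
  ext e
  simp only [edgesWithin, Set.mem_ofPred_eq, Finset.mem_coe, Finset.mem_inter, Finset.mem_sym2_iff]

theorem lamanSparse_of_lamanSparseOn {F : Finset (Sym2 α)} (hd : ∀ e ∈ F, ¬ e.IsDiag)
    {S : Finset α} (hS : ∀ e ∈ F, ∀ v ∈ e, v ∈ S)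
    (h : LamanSparseOn (S : Set α) (F : Set (Sym2 α))) : LamanSparse F := by
  intro W hW
  have heq : F ∩ W.sym2 = F ∩ (W ∩ S).sym2 := by
    ext e; simp only [Finset.mem_inter, Finset.mem_sym2_iff]; grind
  rw [heq]
  have hle : (W ∩ S).card ≤ W.card := Finset.card_le_card Finset.inter_subset_left
  by_cases h2 : 2 ≤ (W ∩ S).card
  · have := h (W ∩ S : Finset α) (by simp) (by rwa [Set.ncard_coe_finset])
    rw [edgesWithin_coe, Set.ncard_coe_finset, Set.ncard_coe_finset] at this
    omega
  · rw [inter_sym2_eq_empty hd (by omega), Finset.card_empty]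
    omega

theorem two_le_card_of_mem {e : Sym2 α} (he : ¬ e.IsDiag) {S : Finset α}
    (h : ∀ v ∈ e, v ∈ S) : 2 ≤ S.card := by
  rw [← Sym2.card_toFinset_of_not_isDiag e he]
  exact Finset.card_le_card fun v hv => h v (Sym2.mem_toFinset.1 hv)

/-- If a set stops being sparse by adding the edge `e`, then `e` lies in a Laman circuit. -/
theorem exists_lamanCircuit [Fintype α] {F : Finset (Sym2 α)} (hd : ∀ e ∈ F, ¬ e.IsDiag)
    {e : Sym2 α} (hsp : LamanSparse (F.erase e)) (hF : ¬ LamanSparse F) :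
    ∃ C ⊆ F, IsLamanCircuitOn (support (C : Set (Sym2 α))) (C : Set (Sym2 α)) ∧ e ∈ C := by
  let P : Finset (Finset α) := Finset.univ.filter fun W =>
    2 ≤ W.card ∧ 2 * W.card < (F ∩ W.sym2).card + 3
  have hP : P.Nonempty := by
    unfold LamanSparse at hF
    push Not at hF
    obtain ⟨W, hW⟩ := hF
    exact ⟨W, by simpa [P] using hW⟩
  obtain ⟨W, hWP, hmin⟩ := Finset.exists_min_image P Finset.card hP
  obtain ⟨hW2, hWlt⟩ : 2 ≤ W.card ∧ 2 * W.card < (F ∩ W.sym2).card + 3 := by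
    simpa [P] using hWP
  have hsmall : ∀ W' : Finset α, 2 ≤ W'.card → W'.card < W.card →
      (F ∩ W'.sym2).card + 3 ≤ 2 * W'.card := by
    intro W' h2 hlt
    by_contra! hcon
    have := hmin W' (by simp [P, h2, hcon])
    omega
  set C := F ∩ W.sym2 with hC
  have hCF : C ⊆ F := Finset.inter_subset_left
  have herase : F.erase e ∩ W.sym2 = C.erase e := Finset.erase_inter _ _ _
  have hbound := hsp W hW2
  rw [herase] at hbound
  have heC : e ∈ C := by
    by_contra he
    rw [Finset.erase_eq_of_notMem he] at hbound
    omega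
  have hCcard : C.card + 2 = 2 * W.card := by
    rw [Finset.card_erase_of_mem heC] at hbound
    omega
  have hsupp : support (C : Set (Sym2 α)) = (W : Set α) := by
    obtain ⟨S, hS⟩ := (support (C : Set (Sym2 α))).toFinite.exists_finset_coe
    have hmem : ∀ f ∈ C, ∀ v ∈ f, v ∈ S := fun f hf v hv => by
      rw [← Finset.mem_coe, hS]
      exact ⟨f, hf, hv⟩
    have hSW : S ⊆ W := fun v hv => by
      rw [← Finset.mem_coe, hS] at hv
      obtain ⟨f, hf, hvf⟩ := hv
      exact Finset.mem_sym2_iff.1 (Finset.mem_inter.1 hf).2 v hvf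
    rw [← hS, Finset.coe_inj]
    refine Finset.eq_of_subset_of_card_le hSW ?_
    by_contra! hlt
    have h2 := two_le_card_of_mem (hd e (hCF heC)) (hmem e heC)
    have h3 := hsmall S h2 hlt
    have h4 : C ⊆ F ∩ S.sym2 := fun f hf =>
      Finset.mem_inter.2 ⟨hCF hf, Finset.mem_sym2_iff.2 (hmem f hf)⟩
    have h5 := Finset.card_le_card h4
    omega
  refine ⟨C, hCF, ?_, heC⟩
  rw [hsupp]
  refine ⟨by simp only [Set.ncard_coe_finset]; omega, fun f hf => ?_⟩
  have hfC : f ∈ C := hf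
  rw [← Finset.coe_erase]
  refine ⟨?_, by simp only [Set.ncard_coe_finset, Finset.card_erase_of_mem hfC]; omega⟩
  intro W' hW' h2
  obtain ⟨W', rfl⟩ := W'.toFinite.exists_finset_coe
  rw [Finset.coe_subset] at hW'
  rw [edgesWithin_coe]
  simp only [Set.ncard_coe_finset] at h2 ⊢
  rcases (Finset.card_le_card hW').lt_or_eq with hlt | heq
  · have h3 := hsmall W' h2 hlt
    have h4 := Finset.card_le_card
      (Finset.inter_subset_inter_right (u := W'.sym2) ((Finset.erase_subset f C).trans hCF))
    omega
  · have h4 := Finset.card_le_card (Finset.inter_subset_left (s₁ := C.erase f) (s₂ := W'.sym2))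
    rw [Finset.card_erase_of_mem hfC] at h4
    omega

end Circuits

/-- In a Laman+1 graph with generic `p` in the plane, an edge is redundant (deleting its
row from `R(p)` does not decrease the rank) iff it lies in the (unique) Laman-circuit
subgraph of `G`. -/
theorem lamanPlusOne_redundant_iff_in_circuit {V : Type*} [Fintype V] [DecidableEq V]
    (G : SimpleGraph V) (hG : IsLamanPlusOne G)
    (p : Cfg V 2) (hp : Generic p) (e : Sym2 V) (he : e ∈ G.edgeSet) :
    rowRank p (G.edgeSet \ {e}) = rowRank p G.edgeSet ↔
      ∃ C ⊆ G.edgeSet, IsLamanCircuitOn (support C) C ∧ e ∈ C := by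
  obtain ⟨hcard, e₀, he₀, hL, hLcard⟩ := hG
  obtain ⟨F, hFG⟩ := G.edgeSet.toFinite.exists_finset_coe
  have hd : ∀ f ∈ F, ¬ f.IsDiag := fun f hf =>
    G.not_isDiag_of_mem_edgeSet (by rw [← hFG]; exact hf)
  rw [← hFG] at hcard he he₀ hL hLcard ⊢
  rw [Finset.mem_coe] at he he₀
  rw [Set.ncard_coe_finset] at hcard
  have hV : 2 ≤ Fintype.card V := two_le_card_of_mem (hd e he) fun v _ => Finset.mem_univ v
  have hd' (f : Sym2 V) : ∀ g ∈ F.erase f, ¬ g.IsDiag :=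
    fun g hg => hd g (Finset.mem_of_mem_erase hg)
  constructor
  · intro hrank
    rw [← Finset.coe_erase, ← Finset.coe_univ] at hL
    have h0 : LamanSparse (F.erase e₀) :=
      lamanSparse_of_lamanSparseOn (hd' e₀) (fun _ _ v _ => Finset.mem_univ v) hL
    have h1 := (linearIndepOn_iff_card_le_rowRank p _).1
      ((hp.linearIndepOn_iff_lamanSparse (hd' e₀)).2 h0)
    have h2 : (F.erase e).card ≤ rowRank p (F.erase e : Finset (Sym2 V)) := by
      rw [Finset.coe_erase, hrank, Finset.card_erase_of_mem he, ← Finset.card_erase_of_mem he₀]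
      exact h1.trans (rowRank_mono p (Finset.coe_subset.2 (Finset.erase_subset _ _)))
    have h3 : LamanSparse (F.erase e) :=
      hp.lamanSparse_of_linearIndepOn ((linearIndepOn_iff_card_le_rowRank p _).2 h2)
    have h4 : ¬ LamanSparse F := fun h => by
      have := h Finset.univ (by rwa [Finset.card_univ])
      rw [Finset.sym2_univ, Finset.inter_univ, Finset.card_univ] at this
      omega
    obtain ⟨C, hCF, hC, heC⟩ := exists_lamanCircuit hd h3 h4
    exact ⟨C, Finset.coe_subset.2 hCF, hC, heC⟩
  · rintro ⟨C, hCF, ⟨hCcard, hC⟩, heC⟩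
    obtain ⟨C, rfl⟩ := (F.finite_toSet.subset hCF).exists_finset_coe
    obtain ⟨S, hS⟩ := (support (C : Set (Sym2 V))).toFinite.exists_finset_coe
    have hmem : ∀ f ∈ C, ∀ v ∈ f, v ∈ S := fun f hf v hv => by
      rw [← Finset.mem_coe, hS]
      exact ⟨f, hf, hv⟩
    have hdC : ∀ f ∈ C, ¬ f.IsDiag := fun f hf => hd f (hCF hf)
    have hS2 : 2 ≤ S.card := two_le_card_of_mem (hd e he) (hmem e heC)
    obtain ⟨hCe, -⟩ := hC e heC
    rw [← hS] at hCe hCcard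
    simp only [Set.ncard_coe_finset] at hCcard
    rw [← Finset.coe_erase] at hCe
    have h1 : LamanSparse (C.erase e) := lamanSparse_of_lamanSparseOn
      (fun f hf => hdC f (Finset.mem_of_mem_erase hf))
      (fun f hf => hmem f (Finset.mem_of_mem_erase hf)) hCe
    have h2 := (hp.linearIndepOn_iff_lamanSparse
      (fun f hf => hdC f (Finset.mem_of_mem_erase hf))).2 h1
    have h3 : ¬ LamanSparse C := fun h => by
      have := h S hS2
      rw [Finset.inter_eq_left.2 fun f hf => Finset.mem_sym2_iff.2 (hmem f hf)] at this
      omega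
    rw [← hp.linearIndepOn_iff_lamanSparse hdC] at h3
    have h4 : rRow p e ∈ Submodule.span ℝ (rRow p '' ((C.erase e : Finset (Sym2 V)) : Set _)) := by
      by_contra hcon
      have := h2.insert hcon
      rw [← Finset.coe_insert, Finset.insert_erase heC] at this
      exact h3 this
    refine rowRank_diff_singleton_eq p (Submodule.span_mono (Set.image_mono ?_) h4)
    rw [Finset.coe_erase]
    exact Set.sdiff_subset_sdiff_left hCF

end CoordRigidity
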